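/- For any harmonic forms h, h' of degree d in n variables, the Bombieri–Weyl inner product satisfies ⟨h,h'⟩ = (2^(d-1)·Γ(d+n/2)/(π^(n/2)·Γ(d+1))) · ∫_{S^(n-1)} h·h' dS^(n-1). -/

import Mathlib

open MeasureTheory MvPolynomial

/-- The Bombieri–Weyl inner product of two real `n`-variate forms:
`⟨f,g⟩ = Σ_{α} C(d,α)⁻¹ f_α g_α` with `C(d,α)` the multinomial coefficient. -/
noncomputable def bwInner {n : ℕ} (f g : MvPolynomial (Fin n) ℝ) : ℝ :=
  ∑ α ∈ f.support ∪ g.support,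
    ((Nat.multinomial Finset.univ fun i => α i : ℝ))⁻¹ * f.coeff α * g.coeff α

section Fischer

variable {σ : Type*} [Fintype σ]

/-- The Fischer pairing `Σ_α α! f_α g_α`, as a linear functional of `f`. -/
noncomputable def fischer (g : MvPolynomial σ ℝ) : MvPolynomial σ ℝ →ₗ[ℝ] ℝ :=
  (basisMonomials σ ℝ).constr ℝ fun α => (∏ i, ((α i).factorial : ℝ)) * g.coeff α

theorem fischer_monomial (g : MvPolynomial σ ℝ) (α : σ →₀ ℕ) (c : ℝ) :
    fischer g (monomial α c) = c * ((∏ i, ((α i).factorial : ℝ)) * g.coeff α) := by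
  have h := (basisMonomials σ ℝ).constr_basis ℝ
    (fun α => (∏ i, ((α i).factorial : ℝ)) * g.coeff α) α
  rw [coe_basisMonomials] at h
  rw [← mul_one c, ← smul_eq_mul, ← smul_monomial, map_smul, fischer, h, smul_eq_mul, smul_eq_mul,
    mul_one]

theorem fischer_eq_sum (f g : MvPolynomial σ ℝ) :
    fischer g f = ∑ α ∈ f.support, (∏ i, ((α i).factorial : ℝ)) * f.coeff α * g.coeff α := by
  conv_lhs => rw [f.as_sum, map_sum]
  refine Finset.sum_congr rfl fun α _ => ?_
  rw [fischer_monomial]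
  ring

/-- Multiplication by `X i` is adjoint to `∂_i` for the Fischer pairing. -/
theorem fischer_X_mul (i : σ) (f g : MvPolynomial σ ℝ) :
    fischer g (X i * f) = fischer (pderiv i g) f := by
  classical
  induction f using MvPolynomial.induction_on' with
  | monomial α c =>
    rw [X, monomial_mul, one_mul, fischer_monomial, fischer_monomial, coeff_pderiv,
      add_comm (Finsupp.single i 1) α]
    have h : ∏ j, (((α + Finsupp.single i 1 : σ →₀ ℕ) j).factorial : ℝ)
        = (α i + 1) * ∏ j, ((α j).factorial : ℝ) := by
      rw [← Finset.mul_prod_erase _ _ (Finset.mem_univ i),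
        ← Finset.mul_prod_erase (a := i) _ (fun j => ((α j).factorial : ℝ)) (Finset.mem_univ i),
        ← mul_assoc]
      congr 1
      · simp [Nat.factorial_succ]
      · refine Finset.prod_congr rfl fun j hj => ?_
        simp [(Finset.ne_of_mem_erase hj).symm]
    rw [h]
    ring
  | add p q hp hq => rw [mul_add, map_add, map_add, hp, hq]

end Fischer

theorem sum_exponents_eq_of_mem_support {σ R : Type*} [Fintype σ] [CommSemiring R] {d : ℕ}
    {f : MvPolynomial σ R} (hf : f.IsHomogeneous d) {α : σ →₀ ℕ} (hα : α ∈ f.support) :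
    ∑ i, α i = d := by
  rw [← hf (mem_support_iff.1 hα), Finsupp.weight_apply, Finsupp.sum_fintype _ _ (by simp)]
  simp

theorem eval_mul_of_isHomogeneous {σ R : Type*} [Fintype σ] [CommSemiring R] {d : ℕ}
    {f : MvPolynomial σ R} (hf : f.IsHomogeneous d) (r : R) (x : σ → R) :
    eval (fun i => r * x i) f = r ^ d * eval x f := by
  rw [eval_eq', eval_eq', Finset.mul_sum]
  refine Finset.sum_congr rfl fun α hα => ?_
  simp only [mul_pow]
  rw [Finset.prod_mul_distrib, Finset.prod_pow_eq_pow_sum, sum_exponents_eq_of_mem_support hf hα,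
    mul_left_comm]

theorem factorial_mul_bwInner {n d : ℕ} {f : MvPolynomial (Fin n) ℝ} (hf : f.IsHomogeneous d)
    (g : MvPolynomial (Fin n) ℝ) : (d.factorial : ℝ) * bwInner f g = fischer g f := by
  have h : bwInner f g = ∑ α ∈ f.support,
      ((Nat.multinomial Finset.univ fun i => α i : ℝ))⁻¹ * f.coeff α * g.coeff α := by
    refine (Finset.sum_subset Finset.subset_union_left fun α _ hα => ?_).symm
    rw [notMem_support_iff.1 hα]
    ring
  rw [h, fischer_eq_sum, Finset.mul_sum]
  refine Finset.sum_congr rfl fun α hα => ?_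
  have hdeg := sum_exponents_eq_of_mem_support hf hα
  have hs : (∏ i, ((α i).factorial : ℝ)) * (Nat.multinomial Finset.univ fun i => α i : ℝ)
      = d.factorial := by
    rw [← hdeg]
    exact_mod_cast Nat.multinomial_spec Finset.univ (fun i => α i)
  have hpos : ((Nat.multinomial Finset.univ fun i => α i : ℕ) : ℝ) ≠ 0 :=
    Nat.cast_ne_zero.2 (Nat.multinomial_pos _ _).ne'
  rw [← hs]
  field_simp

section Gaussian

variable {σ : Type*} [Fintype σ]

/-- The unnormalised standard Gaussian density. -/
noncomputable def gaussWeight (x : σ → ℝ) : ℝ := ∏ i, Real.exp (-(1 / 2) * x i ^ 2)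

theorem gaussWeight_eq (x : σ → ℝ) : gaussWeight x = Real.exp (-(1 / 2) * ∑ i, x i ^ 2) := by
  rw [gaussWeight, ← Real.exp_sum, Finset.mul_sum]

theorem integral_gaussWeight :
    ∫ x : σ → ℝ, gaussWeight x = (2 * Real.pi) ^ ((Fintype.card σ : ℝ) / 2) := by
  simp only [gaussWeight]
  rw [integral_fintype_prod_volume_eq_pow (fun t : ℝ => Real.exp (-(1 / 2) * t ^ 2)),
    integral_gaussian, Real.sqrt_eq_rpow, ← Real.rpow_mul_natCast (by positivity)]
  congr 1 <;> ring

theorem integrable_eval_mul_gaussWeight (p : MvPolynomial σ ℝ) :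
    Integrable fun x : σ → ℝ => eval x p * gaussWeight x := by
  induction p using MvPolynomial.induction_on' with
  | monomial α c =>
    have h : Integrable fun x : σ → ℝ => ∏ i, (x i ^ α i * Real.exp (-(1 / 2) * x i ^ 2)) := by
      refine Integrable.fintype_prod (f := fun i t => t ^ α i * Real.exp (-(1 / 2) * t ^ 2))
        fun i => ?_
      have := integrable_rpow_mul_exp_neg_mul_sq (b := 1 / 2) (by norm_num)
        (s := α i) (by linarith [(α i).cast_nonneg (α := ℝ)])
      simpa using this
    refine (h.const_mul c).congr (.of_forall fun x => ?_)
    simp only [eval_monomial, Finsupp.prod_pow, gaussWeight, Finset.prod_mul_distrib, mul_assoc]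
  | add p q hp hq =>
    exact (hp.add hq).congr (.of_forall fun x => by simp [add_mul])

theorem hasLineDerivAt_eval {σ : Type*} [DecidableEq σ] (p : MvPolynomial σ ℝ) (x : σ → ℝ)
    (i : σ) :
    HasLineDerivAt ℝ (fun y => eval y p) (eval x (pderiv i p)) x (Pi.single i 1) := by
  unfold HasLineDerivAt
  induction p using MvPolynomial.induction_on with
  | C a => simpa using hasDerivAt_const (0 : ℝ) a
  | add p q hp hq => simpa using! hp.add hq
  | mul_X p j hp =>
    have h : HasDerivAt (fun t : ℝ => x j + t * (Pi.single i 1 : σ → ℝ) j)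
        ((Pi.single i 1 : σ → ℝ) j) 0 := by
      simpa using ((hasDerivAt_id (0 : ℝ)).mul_const ((Pi.single i 1 : σ → ℝ) j)).const_add (x j)
    have h2 := hp.mul h
    simp only [pderiv_mul, pderiv_X, map_add, map_mul, eval_X]
    convert! h2 using 1
    rcases eq_or_ne i j with rfl | hij
    · simp
    · simp [Pi.single_eq_of_ne hij.symm]

theorem hasLineDerivAt_gaussWeight [DecidableEq σ] (x : σ → ℝ) (i : σ) :
    HasLineDerivAt ℝ gaussWeight (-(x i * gaussWeight x)) x (Pi.single i 1) := by
  have h := hasLineDerivAt_eval (∑ j, X j ^ 2 : MvPolynomial σ ℝ) x i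
  unfold HasLineDerivAt at h ⊢
  have h2 := (h.const_mul (-(1 / 2) : ℝ)).exp
  convert! h2 using 1
  · ext t; simp [gaussWeight_eq]
  · simp [gaussWeight_eq, Pi.single_apply]
    ring

/-- Integration of a polynomial against `gaussWeight`. -/
noncomputable def gaussIntegral : MvPolynomial σ ℝ →ₗ[ℝ] ℝ where
  toFun p := ∫ x : σ → ℝ, eval x p * gaussWeight x
  map_add' p q := by
    simp only [map_add, add_mul]
    exact integral_add (integrable_eval_mul_gaussWeight p) (integrable_eval_mul_gaussWeight q)
  map_smul' c p := by
    simp only [smul_eval, mul_assoc, integral_const_mul, RingHom.id_apply, smul_eq_mul]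

theorem gaussIntegral_apply (p : MvPolynomial σ ℝ) :
    gaussIntegral p = ∫ x : σ → ℝ, eval x p * gaussWeight x := rfl

/-- Gaussian integration by parts for polynomials. -/
theorem gaussIntegral_X_mul (i : σ) (p : MvPolynomial σ ℝ) :
    gaussIntegral (X i * p) = gaussIntegral (pderiv i p) := by
  classical
  have h := integral_bilinear_hasLineDerivAt_right_eq_neg_left_of_integrable
    (μ := (volume : Measure (σ → ℝ))) (B := ContinuousLinearMap.mul ℝ ℝ) (v := Pi.single i 1)
    (f := fun x => eval x p) (f' := fun x => eval x (pderiv i p))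
    (g := gaussWeight) (g' := fun x => -(x i * gaussWeight x))
    (by simpa using integrable_eval_mul_gaussWeight (pderiv i p))
    (by
      refine (integrable_eval_mul_gaussWeight (X i * p)).neg.congr (.of_forall fun x => ?_)
      simp
      ring)
    (by simpa using integrable_eval_mul_gaussWeight p)
    (fun x _ => hasLineDerivAt_eval p x i) (fun x _ => hasLineDerivAt_gaussWeight x i)
  simp only [ContinuousLinearMap.mul_apply', mul_neg, integral_neg, neg_inj] at h
  rw [gaussIntegral_apply, gaussIntegral_apply, ← h]
  congr 1 with x
  simp
  ring

end Gaussian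

theorem pderiv_pderiv_comm {σ : Type*} (i j : σ) (p : MvPolynomial σ ℝ) :
    pderiv i (pderiv j p) = pderiv j (pderiv i p) := by
  classical
  ext m
  rcases eq_or_ne i j with rfl | hij
  · rfl
  · simp only [coeff_pderiv, add_right_comm m, Finsupp.add_apply, Finsupp.single_eq_of_ne hij,
      Finsupp.single_eq_of_ne hij.symm, add_zero]
    ring

/-- If one factor is harmonic, the Gaussian pairing of two forms is a multiple of their Fischer
pairing. -/
theorem gaussIntegral_mul_eq_fischer {σ : Type*} [Fintype σ] {d : ℕ} {f g : MvPolynomial σ ℝ}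
    (hf : f.IsHomogeneous d) (hg : g.IsHomogeneous d) (hharm : ∑ i, pderiv i (pderiv i f) = 0) :
    gaussIntegral (f * g) = (2 * Real.pi) ^ ((Fintype.card σ : ℝ) / 2) * fischer g f := by
  induction d generalizing f g with
  | zero =>
    obtain ⟨a, rfl⟩ : ∃ a, f = C a :=
      ⟨_, (totalDegree_eq_zero_iff_eq_C).1 ((totalDegree_zero_iff_isHomogeneous _).2 hf)⟩
    obtain ⟨b, rfl⟩ : ∃ b, g = C b :=
      ⟨_, (totalDegree_eq_zero_iff_eq_C).1 ((totalDegree_zero_iff_isHomogeneous _).2 hg)⟩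
    rw [gaussIntegral_apply]
    simp only [map_mul, eval_C]
    rw [integral_const_mul, integral_gaussWeight, C_apply (a := a), fischer_monomial]
    simp
    ring
  | succ d ih =>
    have key (i : σ) : gaussIntegral (X i * pderiv i f * g) =
        gaussIntegral (pderiv i (pderiv i f) * g) +
          (2 * Real.pi) ^ ((Fintype.card σ : ℝ) / 2) * fischer g (X i * pderiv i f) := by
      rw [mul_assoc, gaussIntegral_X_mul, pderiv_mul, map_add, fischer_X_mul,
        ih hf.pderiv hg.pderiv]
      simp only [pderiv_pderiv_comm _ i]
      rw [← map_sum, hharm, map_zero]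
    have hsum := Finset.sum_congr (rfl : (Finset.univ : Finset σ) = Finset.univ)
      fun i _ => key i
    rw [Finset.sum_add_distrib, ← map_sum, ← map_sum, ← Finset.mul_sum, ← map_sum,
      ← Finset.sum_mul, ← Finset.sum_mul, hharm, hf.sum_X_mul_pderiv, zero_mul, map_zero, zero_add,
      smul_mul_assoc, map_nsmul, map_nsmul, nsmul_eq_mul, nsmul_eq_mul, mul_left_comm] at hsum
    exact mul_left_cancel₀ (Nat.cast_ne_zero.2 d.succ_ne_zero) hsum

/-- Polar integration of a positively homogeneous function against a radial one. -/
theorem integral_homogeneous_mul_radial {E : Type*} [NormedAddCommGroup E] [NormedSpace ℝ E]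
    [FiniteDimensional ℝ E] [Nontrivial E] [MeasurableSpace E] [BorelSpace E] (μ : Measure E)
    [μ.IsAddHaarMeasure] (f : E → ℝ) (k : ℕ) (hf : ∀ (r : ℝ) (x : E), f (r • x) = r ^ k * f x)
    (g : ℝ → ℝ) :
    ∫ x, f x * g ‖x‖ ∂μ = (∫ x : Metric.sphere (0 : E) 1, f x ∂μ.toSphere) *
      ∫ y in Set.Ioi (0 : ℝ), y ^ (Module.finrank ℝ E - 1) * (y ^ k * g y) :=
  calc
    ∫ x, f x * g ‖x‖ ∂μ = ∫ x : ({(0)}ᶜ : Set E), f x.1 * g ‖x.1‖ ∂(μ.comap (↑)) := by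
      rw [integral_subtype_comap (measurableSet_singleton _).compl fun x ↦ f x * g ‖x‖,
        restrict_compl_singleton]
    _ = ∫ x : Metric.sphere (0 : E) 1 × Set.Ioi (0 : ℝ), f x.1 * (x.2.1 ^ k * g x.2.1)
          ∂μ.toSphere.prod (.volumeIoiPow (Module.finrank ℝ E - 1)) := by
      rw [← μ.measurePreserving_homeomorphUnitSphereProd.integral_comp
        (Homeomorph.measurableEmbedding _)]
      refine integral_congr_ae (.of_forall fun x => ?_)
      have hx : ‖x.1‖ ≠ 0 := norm_ne_zero_iff.2 x.2
      simp only [homeomorphUnitSphereProd_apply_snd_coe, homeomorphUnitSphereProd_apply_fst_coe, hf]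
      rw [mul_left_comm, mul_assoc, ← mul_assoc, ← mul_pow, mul_comm ‖x.1‖, inv_mul_cancel₀ hx, one_pow,
        one_mul]
    _ = (∫ x : Metric.sphere (0 : E) 1, f x ∂μ.toSphere) *
          ∫ y : Set.Ioi (0 : ℝ), y.1 ^ k * g y.1 ∂.volumeIoiPow (Module.finrank ℝ E - 1) :=
      integral_prod_mul (fun x : Metric.sphere (0 : E) 1 => f x)
        (fun y : Set.Ioi (0 : ℝ) => y.1 ^ k * g y.1)
    _ = _ := by
      simp only [Measure.volumeIoiPow, ENNReal.ofReal]
      rw [integral_withDensity_eq_integral_smul, integral_subtype_comap measurableSet_Ioi fun a ↦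
        Real.toNNReal (a ^ (Module.finrank ℝ E - 1)) • (a ^ k * g a),
        setIntegral_congr_fun measurableSet_Ioi fun x hx ↦ ?_]
      · rw [NNReal.smul_def, Real.coe_toNNReal _ (pow_nonneg hx.out.le _), smul_eq_mul]
      · exact (measurable_subtype_coe.pow_const _).real_toNNReal

theorem integral_pow_mul_pow_mul_exp_neg_half_sq {n : ℕ} (hn : 1 ≤ n) (d : ℕ) :
    ∫ y in Set.Ioi (0 : ℝ), y ^ (n - 1) * (y ^ (d + d) * Real.exp (-(1 / 2) * y ^ 2)) =
      (2 : ℝ) ^ ((d : ℝ) + n / 2) / 2 * Real.Gamma ((d : ℝ) + n / 2) := by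
  have h := integral_rpow_mul_exp_neg_mul_rpow (p := 2) (q := ((n - 1 + (d + d) : ℕ) : ℝ))
    (b := 1 / 2) two_pos (neg_one_lt_zero.trans_le (Nat.cast_nonneg _)) (by norm_num)
  have hq : (((n - 1 + (d + d) : ℕ) : ℝ) + 1) / 2 = d + n / 2 := by
    push_cast [Nat.cast_sub hn]
    ring
  rw [neg_div, hq, one_div, Real.inv_rpow two_pos.le, Real.rpow_neg two_pos.le, inv_inv,
    ← div_eq_mul_inv] at h
  rw [← h]
  simp only [Real.rpow_natCast, Real.rpow_two, pow_add, mul_assoc, one_div]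

theorem gaussIntegral_mul_eq_integral_toSphere {n d : ℕ} (hn : 1 ≤ n)
    {f g : MvPolynomial (Fin n) ℝ} (hf : f.IsHomogeneous d) (hg : g.IsHomogeneous d) :
    gaussIntegral (f * g) =
      (∫ x : Metric.sphere (0 : EuclideanSpace ℝ (Fin n)) 1,
        (eval (fun i => (x : EuclideanSpace ℝ (Fin n)) i) f) *
          (eval (fun i => (x : EuclideanSpace ℝ (Fin n)) i) g)
        ∂(volume : Measure (EuclideanSpace ℝ (Fin n))).toSphere) *
      ((2 : ℝ) ^ ((d : ℝ) + n / 2) / 2 * Real.Gamma ((d : ℝ) + n / 2)) := by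
  have : Nonempty (Fin n) := ⟨⟨0, hn⟩⟩
  have hpolar := integral_homogeneous_mul_radial (volume : Measure (EuclideanSpace ℝ (Fin n)))
    (fun x => eval (fun i => x i) f * eval (fun i => x i) g) (d + d)
    (fun r x => by
      simp only [PiLp.smul_apply, smul_eq_mul, eval_mul_of_isHomogeneous hf,
        eval_mul_of_isHomogeneous hg]
      ring)
    (fun t => Real.exp (-(1 / 2) * t ^ 2))
  rw [finrank_euclideanSpace_fin, integral_pow_mul_pow_mul_exp_neg_half_sq hn] at hpolar
  rw [← hpolar, gaussIntegral_apply,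
    ← (PiLp.volume_preserving_ofLp (Fin n)).integral_comp
      (MeasurableEquiv.toLp 2 (Fin n → ℝ)).symm.measurableEmbedding]
  simp only [map_mul, gaussWeight_eq, EuclideanSpace.real_norm_sq_eq]

/-- For harmonic forms `h, h'` of degree `d` in `n` variables, the Bombieri–Weyl inner
product equals `(2^(d-1)·Γ(d+n/2)/(π^(n/2)·Γ(d+1)))` times the `L²(S^(n-1))` inner product. -/
theorem stmt_8 (n d : ℕ) (hn : 2 ≤ n) (h h' : MvPolynomial (Fin n) ℝ)
    (hh : h.IsHomogeneous d) (hh' : h'.IsHomogeneous d)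
    (hharm : ∑ i, pderiv i (pderiv i h) = 0)
    (hharm' : ∑ i, pderiv i (pderiv i h') = 0) :
    bwInner h h' =
      (2 : ℝ) ^ ((d : ℝ) - 1) * Real.Gamma ((d : ℝ) + (n : ℝ) / 2) /
          (Real.pi ^ ((n : ℝ) / 2) * Real.Gamma ((d : ℝ) + 1)) *
        ∫ x : Metric.sphere (0 : EuclideanSpace ℝ (Fin n)) 1,
          (eval (fun i => (x : EuclideanSpace ℝ (Fin n)) i) h) *
            (eval (fun i => (x : EuclideanSpace ℝ (Fin n)) i) h')
          ∂(volume : Measure (EuclideanSpace ℝ (Fin n))).toSphere := by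
  have key := gaussIntegral_mul_eq_fischer hh hh' hharm
  rw [gaussIntegral_mul_eq_integral_toSphere (by omega) hh hh', ← factorial_mul_bwInner hh,
    Fintype.card_fin, Real.mul_rpow two_pos.le Real.pi_pos.le, Real.rpow_add two_pos] at key
  rw [Real.Gamma_nat_eq_factorial, Real.rpow_sub two_pos, Real.rpow_one]
  have hpi : Real.pi ^ ((n : ℝ) / 2) ≠ 0 := (Real.rpow_pos_of_pos Real.pi_pos _).ne'
  have htwo : (2 : ℝ) ^ ((n : ℝ) / 2) ≠ 0 := (Real.rpow_pos_of_pos two_pos _).ne'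
  have hfac : (d.factorial : ℝ) ≠ 0 := Nat.cast_ne_zero.2 d.factorial_ne_zero
  rw [div_mul_eq_mul_div, eq_div_iff (mul_ne_zero hpi hfac)]
  apply mul_left_cancel₀ htwo
  linear_combination -key
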